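/- arXiv:2404.12951 — 2 statements merged into one kernel-verified Lean document; each statement's English description precedes it below -/
import Mathlib

section
/- (Confluence of the distant Bang calculus.) (Surface) The surface reduction →S of λ! is confluent; moreover, any two surface reduction sequences from a common term to a →S-normal form have the same length and contain the same number of dB-steps, of s!-steps and of d!-steps. (Full) The full reduction →F of λ! is confluent. -/
namespace BangPaper

/-! ### Generic rewriting notions -/

/-- `a` is a normal form for the relation `r`. -/
def IsNF {α : Type*} (r : α → α → Prop) (a : α) : Prop := ∀ b, ¬ r a b

/-- Reflexive-transitive closure of the union of two relations,
counting the number of steps of each. -/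
inductive Counted2 {α : Type*} (r₁ r₂ : α → α → Prop) : ℕ → ℕ → α → α → Prop
  | refl (t : α) : Counted2 r₁ r₂ 0 0 t t
  | step₁ {t u v : α} {m n : ℕ} :
      r₁ t u → Counted2 r₁ r₂ m n u v → Counted2 r₁ r₂ (m + 1) n t v
  | step₂ {t u v : α} {m n : ℕ} :
      r₂ t u → Counted2 r₁ r₂ m n u v → Counted2 r₁ r₂ m (n + 1) t v

/-- Reflexive-transitive closure of the union of three relations,
counting the number of steps of each. -/
inductive Counted3 {α : Type*} (r₁ r₂ r₃ : α → α → Prop) : ℕ → ℕ → ℕ → α → α → Prop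
  | refl (t : α) : Counted3 r₁ r₂ r₃ 0 0 0 t t
  | step₁ {t u v : α} {m n k : ℕ} :
      r₁ t u → Counted3 r₁ r₂ r₃ m n k u v → Counted3 r₁ r₂ r₃ (m + 1) n k t v
  | step₂ {t u v : α} {m n k : ℕ} :
      r₂ t u → Counted3 r₁ r₂ r₃ m n k u v → Counted3 r₁ r₂ r₃ m (n + 1) k t v
  | step₃ {t u v : α} {m n k : ℕ} :
      r₃ t u → Counted3 r₁ r₂ r₃ m n k u v → Counted3 r₁ r₂ r₃ m n (k + 1) t v

/-! ### Terms of the distant Bang calculus λ! (de Bruijn representation) -/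

/-- Terms of λ!: variables, application, abstraction, bang, dereliction and
explicit substitution (`sub t u` is `t[x←u]`, the binder being in `t`). -/
inductive T : Type
  | var : ℕ → T
  | app : T → T → T
  | lam : T → T
  | bang : T → T
  | der : T → T
  | sub : T → T → T

namespace T

/-- Lift (shift by one) the free de Bruijn variables `≥ k`. -/
def lift (k : ℕ) : T → T
  | var n => if n < k then var n else var (n + 1)
  | app a b => app (lift k a) (lift k b)
  | lam a => lam (lift (k + 1) a)
  | bang a => bang (lift k a)
  | der a => der (lift k a)
  | sub a b => sub (lift (k + 1) a) (lift k b)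

/-- Lift all free variables by `m` (crossing `m` binders). -/
def liftN (m : ℕ) (t : T) : T := (lift 0)^[m] t

/-- Lift all free variables except the first one by `m`
(used to push a term with one distinguished bound variable under `m` extra binders). -/
def liftUnder (m : ℕ) (t : T) : T := (lift 1)^[m] t

/-- Capture-avoiding substitution `t{k := u}` of `u` for de Bruijn variable `k`. -/
def subst : T → ℕ → T → T
  | var n, k, u => if n < k then var n else if n = k then liftN k u else var (n - 1)
  | app a b, k, u => app (subst a k u) (subst b k u)
  | lam a, k, u => lam (subst a (k + 1) u)
  | bang a, k, u => bang (subst a k u)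
  | der a, k, u => der (subst a k u)
  | sub a b, k, u => sub (subst a (k + 1) u) (subst b k u)

/-- The number of constructors (full size) of a term: it counts all
applications, abstractions, explicit substitutions, `!` and `der` occurrences. -/
def size : T → ℕ
  | var _ => 0
  | app a b => 1 + size a + size b
  | lam a => 1 + size a
  | bang a => 1 + size a
  | der a => 1 + size a
  | sub a b => 1 + size a + size b

end T

/-- Plugging a term into a list context `⟨·⟩[x₁←t₁]…[xₙ←tₙ]`
(represented as the list `[t₁, …, tₙ]`). -/
def fillL : T → List T → T
  | s, [] => s
  | s, t :: L => fillL (T.sub s t) L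

/-! ### Rewrite rules of λ! -/

/-- The names of the three rewrite rules of λ!: `dB`, `s!` and `d!`. -/
inductive Rule : Type
  | dB : Rule
  | sBang : Rule
  | dBang : Rule

/-- Root steps of the three rewrite rules of λ! (at a distance, capture-free):
`(dB)  L⟨λx.t⟩ u ↦ L⟨t[x←u]⟩`, `(s!)  t[x←L⟨!u⟩] ↦ L⟨t{x:=u}⟩`,
`(d!)  der(L⟨!t⟩) ↦ L⟨t⟩`. -/
inductive Root : Rule → T → T → Prop
  | dB (t u : T) (L : List T) :
      Root Rule.dB (T.app (fillL (T.lam t) L) u)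
        (fillL (T.sub t (T.liftN L.length u)) L)
  | sBang (t u : T) (L : List T) :
      Root Rule.sBang (T.sub t (fillL (T.bang u) L))
        (fillL (T.subst (T.liftUnder L.length t) 0 u) L)
  | dBang (t : T) (L : List T) :
      Root Rule.dBang (T.der (fillL (T.bang t) L)) (fillL t L)

/-! ### Contexts of λ! -/

/-- (Full) contexts of λ!: terms with exactly one hole, the hole may occur anywhere. -/
inductive Ctx : Type
  | hole : Ctx
  | appL : Ctx → T → Ctx
  | appR : T → Ctx → Ctx
  | lam : Ctx → Ctx
  | bang : Ctx → Ctx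
  | der : Ctx → Ctx
  | subL : Ctx → T → Ctx
  | subR : T → Ctx → Ctx

namespace Ctx

/-- Plugging a term in a context (possibly capturing its free variables). -/
def fill : Ctx → T → T
  | hole, s => s
  | appL C t, s => T.app (fill C s) t
  | appR t C, s => T.app t (fill C s)
  | lam C, s => T.lam (fill C s)
  | bang C, s => T.bang (fill C s)
  | der C, s => T.der (fill C s)
  | subL C t, s => T.sub (fill C s) t
  | subR t C, s => T.sub t (fill C s)

/-- Surface contexts: the hole does not occur under a `!`. -/
def Surface : Ctx → Prop
  | hole => True
  | appL C _ => Surface C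
  | appR _ C => Surface C
  | lam C => Surface C
  | bang _ => False
  | der C => Surface C
  | subL C _ => Surface C
  | subR _ C => Surface C

/-- Internal contexts: the full contexts that are not surface (the hole occurs under a `!`). -/
def Internal (C : Ctx) : Prop := ¬ Surface C

end Ctx

/-! ### Reductions of λ! -/

/-- `StepAt R C t u`: `t` rewrites to `u` by firing a redex of rule `R` under context `C`. -/
def StepAt (R : Rule) (C : Ctx) (t u : T) : Prop :=
  ∃ a b, Root R a b ∧ t = C.fill a ∧ u = C.fill b

/-- One step of rule `R` under some full context (`→F,R`). -/
def FStepR (R : Rule) (t u : T) : Prop := ∃ C : Ctx, StepAt R C t u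

/-- One step of rule `R` under some surface context (`→S,R`). -/
def SStepR (R : Rule) (t u : T) : Prop := ∃ C : Ctx, C.Surface ∧ StepAt R C t u

/-- One step of rule `R` under some internal context (`→I,R`). -/
def IStepR (R : Rule) (t u : T) : Prop := ∃ C : Ctx, C.Internal ∧ StepAt R C t u

/-- Full reduction `→F` of λ!. -/
def FStep (t u : T) : Prop := ∃ R, FStepR R t u

/-- Surface reduction `→S` of λ!. -/
def SStep (t u : T) : Prop := ∃ R, SStepR R t u

/-- Internal reduction `→I` of λ!. -/
def IStep (t u : T) : Prop := ∃ R, IStepR R t u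

/-- Diligent administrative surface reduction `→Sai`: `d!`-surface steps, together with
`dB`- and `s!`-surface steps whose source is a `→S,d!`-normal form. -/
def SaiStep (t u : T) : Prop :=
  SStepR Rule.dBang t u ∨
    ((SStepR Rule.dB t u ∨ SStepR Rule.sBang t u) ∧ IsNF (SStepR Rule.dBang) t)

/-- Diligent administrative full reduction `→Fai`: `d!`-full steps, together with
`dB`- and `s!`-full steps whose source is a `→F,d!`-normal form. -/
def FaiStep (t u : T) : Prop :=
  FStepR Rule.dBang t u ∨
    ((FStepR Rule.dB t u ∨ FStepR Rule.sBang t u) ∧ IsNF (FStepR Rule.dBang) t)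

/-! ### Terms of the CBN / CBV calculi (shared syntax, de Bruijn) -/

/-- Terms of the CBN/CBV calculi: variables, application, abstraction and
explicit substitution (no `!`, no `der`). -/
inductive LT : Type
  | var : ℕ → LT
  | app : LT → LT → LT
  | lam : LT → LT
  | sub : LT → LT → LT

namespace LT

/-- Lift (shift by one) the free de Bruijn variables `≥ k`. -/
def lift (k : ℕ) : LT → LT
  | var n => if n < k then var n else var (n + 1)
  | app a b => app (lift k a) (lift k b)
  | lam a => lam (lift (k + 1) a)
  | sub a b => sub (lift (k + 1) a) (lift k b)

/-- Lift all free variables by `m`. -/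
def liftN (m : ℕ) (t : LT) : LT := (lift 0)^[m] t

/-- Lift all free variables except the first one by `m`. -/
def liftUnder (m : ℕ) (t : LT) : LT := (lift 1)^[m] t

/-- Capture-avoiding substitution `t{k := u}`. -/
def subst : LT → ℕ → LT → LT
  | var n, k, u => if n < k then var n else if n = k then liftN k u else var (n - 1)
  | app a b, k, u => app (subst a k u) (subst b k u)
  | lam a, k, u => lam (subst a (k + 1) u)
  | sub a b, k, u => sub (subst a (k + 1) u) (subst b k u)

/-- Values: variables and abstractions. -/
def IsValue : LT → Prop
  | var _ => True
  | lam _ => True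
  | _ => False

end LT

/-- Plugging a CBN/CBV term into a list context. -/
def fillLN : LT → List LT → LT
  | s, [] => s
  | s, t :: L => fillLN (LT.sub s t) L

/-- The names of the CBN rewrite rules: `dB` and `s`. -/
inductive NRule : Type
  | dB : NRule
  | s : NRule

/-- Root steps of the CBN rules:
`(dB) L⟨λx.t⟩ u ↦ L⟨t[x←u]⟩` and `(s) t[x←u] ↦ t{x:=u}`. -/
inductive NRoot : NRule → LT → LT → Prop
  | dB (t u : LT) (L : List LT) :
      NRoot NRule.dB (LT.app (fillLN (LT.lam t) L) u)
        (fillLN (LT.sub t (LT.liftN L.length u)) L)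
  | s (t u : LT) : NRoot NRule.s (LT.sub t u) (LT.subst t 0 u)

/-- The names of the CBV rewrite rules: `dB` and `sV`. -/
inductive VRule : Type
  | dB : VRule
  | sV : VRule

/-- Root steps of the CBV rules:
`(dB) L⟨λx.t⟩ u ↦ L⟨t[x←u]⟩` and `(sV) t[x←L⟨v⟩] ↦ L⟨t{x:=v}⟩` for `v` a value. -/
inductive VRoot : VRule → LT → LT → Prop
  | dB (t u : LT) (L : List LT) :
      VRoot VRule.dB (LT.app (fillLN (LT.lam t) L) u)
        (fillLN (LT.sub t (LT.liftN L.length u)) L)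
  | sV (t v : LT) (L : List LT) : v.IsValue →
      VRoot VRule.sV (LT.sub t (fillLN v L))
        (fillLN (LT.subst (LT.liftUnder L.length t) 0 v) L)

/-- (Full) contexts of the CBN/CBV calculi. -/
inductive LCtx : Type
  | hole : LCtx
  | appL : LCtx → LT → LCtx
  | appR : LT → LCtx → LCtx
  | lam : LCtx → LCtx
  | subL : LCtx → LT → LCtx
  | subR : LT → LCtx → LCtx

namespace LCtx

/-- Plugging a term in a CBN/CBV context. -/
def fill : LCtx → LT → LT
  | hole, s => s
  | appL C t, s => LT.app (fill C s) t
  | appR t C, s => LT.app t (fill C s)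
  | lam C, s => LT.lam (fill C s)
  | subL C t, s => LT.sub (fill C s) t
  | subR t C, s => LT.sub t (fill C s)

/-- CBN surface contexts: the hole never occurs in the argument of an application
or of an explicit substitution. -/
def NSurface : LCtx → Prop
  | hole => True
  | appL C _ => NSurface C
  | appR _ _ => False
  | lam C => NSurface C
  | subL C _ => NSurface C
  | subR _ _ => False

/-- CBV surface contexts: the hole never occurs under an abstraction. -/
def VSurface : LCtx → Prop
  | hole => True
  | appL C _ => VSurface C
  | appR _ C => VSurface C
  | lam _ => False
  | subL C _ => VSurface C
  | subR _ C => VSurface C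

end LCtx

/-- `NStepAt R C t u`: the CBN step firing rule `R` under context `C`. -/
def NStepAt (R : NRule) (C : LCtx) (t u : LT) : Prop :=
  ∃ a b, NRoot R a b ∧ t = C.fill a ∧ u = C.fill b

/-- `VStepAt R C t u`: the CBV step firing rule `R` under context `C`. -/
def VStepAt (R : VRule) (C : LCtx) (t u : LT) : Prop :=
  ∃ a b, VRoot R a b ∧ t = C.fill a ∧ u = C.fill b

/-- One CBN step of rule `R` under some full context. -/
def NFStepR (R : NRule) (t u : LT) : Prop := ∃ C : LCtx, NStepAt R C t u

/-- One CBN step of rule `R` under some surface context. -/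
def NSStepR (R : NRule) (t u : LT) : Prop := ∃ C : LCtx, C.NSurface ∧ NStepAt R C t u

/-- One CBN step of rule `R` under some internal context. -/
def NIStepR (R : NRule) (t u : LT) : Prop := ∃ C : LCtx, ¬ C.NSurface ∧ NStepAt R C t u

/-- CBN full reduction `→ⁿF`. -/
def NFStep (t u : LT) : Prop := ∃ R, NFStepR R t u

/-- CBN surface reduction `→ⁿS`. -/
def NSStep (t u : LT) : Prop := ∃ R, NSStepR R t u

/-- CBN internal reduction `→ⁿI`. -/
def NIStep (t u : LT) : Prop := ∃ R, NIStepR R t u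

/-- One CBV step of rule `R` under some full context. -/
def VFStepR (R : VRule) (t u : LT) : Prop := ∃ C : LCtx, VStepAt R C t u

/-- One CBV step of rule `R` under some surface context. -/
def VSStepR (R : VRule) (t u : LT) : Prop := ∃ C : LCtx, C.VSurface ∧ VStepAt R C t u

/-- One CBV step of rule `R` under some internal context. -/
def VIStepR (R : VRule) (t u : LT) : Prop := ∃ C : LCtx, ¬ C.VSurface ∧ VStepAt R C t u

/-- CBV full reduction `→ᵛF`. -/
def VFStep (t u : LT) : Prop := ∃ R, VFStepR R t u

/-- CBV surface reduction `→ᵛS`. -/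
def VSStep (t u : LT) : Prop := ∃ R, VSStepR R t u

/-- CBV internal reduction `→ᵛI`. -/
def VIStep (t u : LT) : Prop := ∃ R, VIStepR R t u

/-! ### The CBN embedding into λ! -/

/-- The CBN embedding `(·)ⁿ : xⁿ = x, (λx.t)ⁿ = λx.tⁿ, (t u)ⁿ = tⁿ !(uⁿ),
(t[x←u])ⁿ = tⁿ[x←!(uⁿ)]`. -/
def embN : LT → T
  | LT.var n => T.var n
  | LT.app t u => T.app (embN t) (T.bang (embN u))
  | LT.lam t => T.lam (embN t)
  | LT.sub t u => T.sub (embN t) (T.bang (embN u))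

/-- The CBN embedding extended to contexts, with `⟨·⟩ⁿ = ⟨·⟩`. -/
def embNC : LCtx → Ctx
  | LCtx.hole => Ctx.hole
  | LCtx.appL C t => Ctx.appL (embNC C) (T.bang (embN t))
  | LCtx.appR t C => Ctx.appR (embN t) (Ctx.bang (embNC C))
  | LCtx.lam C => Ctx.lam (embNC C)
  | LCtx.subL C t => Ctx.subL (embNC C) (T.bang (embN t))
  | LCtx.subR t C => Ctx.subR (embN t) (Ctx.bang (embNC C))

/-- The CBN embedding on rule names: `dBⁿ = dB`, `sⁿ = s!`. -/
def embNRule : NRule → Rule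
  | NRule.dB => Rule.dB
  | NRule.s => Rule.sBang

/-! ### The CBV embedding into λ! -/

/-- If `t = L⟨!s⟩` for a list context `L`, return `some L⟨s⟩`, otherwise `none`. -/
def strip? : T → Option T
  | T.bang s => some s
  | T.sub a b => (strip? a).map (fun a' => T.sub a' b)
  | _ => none

/-- The (new) CBV embedding `(·)ᵛ : xᵛ = !x, (λx.t)ᵛ = !λx.!(tᵛ),
(t u)ᵛ = der(L⟨s⟩ uᵛ)` if `tᵛ = L⟨!s⟩` and `der(der(tᵛ) uᵛ)` otherwise,
`(t[x←u])ᵛ = tᵛ[x←uᵛ]`. -/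
def embV : LT → T
  | LT.var n => T.bang (T.var n)
  | LT.lam t => T.bang (T.lam (T.bang (embV t)))
  | LT.app t u =>
      match strip? (embV t) with
      | some s => T.der (T.app s (embV u))
      | none => T.der (T.app (T.der (embV t)) (embV u))
  | LT.sub t u => T.sub (embV t) (embV u)

/-- The CBV embedding on rule names: `dBᵛ = dB`, `sVᵛ = s!`. -/
def embVRule : VRule → Rule
  | VRule.dB => Rule.dB
  | VRule.sV => Rule.sBang

namespace T

theorem lift_lift_of_le (t : T) {i j : ℕ} (h : i ≤ j) :
    lift i (lift j t) = lift (j + 1) (lift i t) := by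
  induction t generalizing i j with
  | var n => simp only [lift]; split_ifs <;> simp only [lift] <;> split_ifs <;> grind
  | app a b iha ihb => simp only [lift, iha h, ihb h]
  | lam a ih => simp only [lift, ih (Nat.succ_le_succ h)]
  | bang a ih => simp only [lift, ih h]
  | der a ih => simp only [lift, ih h]
  | sub a b iha ihb => simp only [lift, iha (Nat.succ_le_succ h), ihb h]

theorem liftN_succ (m : ℕ) (t : T) : liftN (m + 1) t = lift 0 (liftN m t) :=
  Function.iterate_succ_apply' _ _ _

theorem lift_liftN (k j : ℕ) (u : T) : lift (k + j) (liftN j u) = liftN j (lift k u) := by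
  induction j with
  | zero => rfl
  | succ j ih => rw [liftN_succ, liftN_succ, ← ih, lift_lift_of_le _ (Nat.zero_le _)]; rfl

theorem lift_liftN_of_le {i k : ℕ} (h : i ≤ k) (u : T) :
    lift i (liftN k u) = liftN (k + 1) u := by
  obtain ⟨m, rfl⟩ := Nat.exists_eq_add_of_le h
  induction i generalizing m with
  | zero => rw [liftN_succ]
  | succ i ih =>
    rw [show i + 1 + m = i + m + 1 by omega, liftN_succ, ← lift_lift_of_le _ (Nat.zero_le _),
      ih _ (Nat.le_add_right _ _), ← liftN_succ]

theorem subst_lift (t : T) (k : ℕ) (v : T) : subst (lift k t) k v = t := by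
  induction t generalizing k with
  | var n => simp only [lift]; split_ifs <;> simp only [subst] <;> split_ifs <;> grind
  | app a b iha ihb => simp only [lift, subst, iha, ihb]
  | lam a ih => simp only [lift, subst, ih]
  | bang a ih => simp only [lift, subst, ih]
  | der a ih => simp only [lift, subst, ih]
  | sub a b iha ihb => simp only [lift, subst, iha, ihb]

theorem lift_subst (t : T) (k j : ℕ) (u : T) :
    lift (k + j) (subst t j u) = subst (lift (k + j + 1) t) j (lift k u) := by
  induction t generalizing j with
  | var n =>
    rcases lt_trichotomy n j with h | rfl | h
    · simp only [subst, lift, if_pos h, if_pos (show n < k + j by omega),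
        if_pos (show n < k + j + 1 by omega)]
    · simp only [subst, lift, lt_irrefl, if_true, if_false, if_pos (show n < k + n + 1 by omega),
        lift_liftN]
    · simp only [subst, lift, if_neg (show ¬ n < j by omega), if_neg (show n ≠ j by omega)]
      split_ifs <;> simp only [subst] <;> split_ifs <;> grind
  | app a b iha ihb => simp only [lift, subst, iha, ihb]
  | lam a ih => simp only [lift, subst]; rw [Nat.add_assoc k j 1, ih]
  | bang a ih => simp only [lift, subst, ih]
  | der a ih => simp only [lift, subst, ih]
  | sub a b iha ihb => simp only [lift, subst, ihb]; rw [Nat.add_assoc k j 1, iha]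

theorem lift_subst_of_le (t : T) {i k : ℕ} (h : i ≤ k) (u : T) :
    lift i (subst t k u) = subst (lift i t) (k + 1) u := by
  induction t generalizing i k with
  | var n =>
    rcases lt_trichotomy n k with hn | rfl | hn
    · simp only [subst, lift, if_pos hn]
      split_ifs <;> simp only [subst] <;> split_ifs <;> grind
    · simp only [subst, lift, lt_irrefl, if_true, if_false, if_neg (show ¬ n < i by omega),
        lift_liftN_of_le h]
    · simp only [subst, lift, if_neg (show ¬ n < k by omega), if_neg (show n ≠ k by omega)]
      split_ifs <;> simp only [subst] <;> split_ifs <;> grind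
  | app a b iha ihb => simp only [lift, subst, iha h, ihb h]
  | lam a ih => simp only [lift, subst, ih (Nat.succ_le_succ h)]
  | bang a ih => simp only [lift, subst, ih h]
  | der a ih => simp only [lift, subst, ih h]
  | sub a b iha ihb => simp only [lift, subst, iha (Nat.succ_le_succ h), ihb h]

theorem subst_liftN (u : T) (j k : ℕ) (v : T) :
    subst (liftN j u) (k + j) v = liftN j (subst u k v) := by
  induction j with
  | zero => rfl
  | succ j ih =>
    rw [liftN_succ, liftN_succ, ← ih, lift_subst_of_le _ (Nat.zero_le _)]; rfl

theorem subst_subst (t : T) (j k : ℕ) (u v : T) :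
    subst (subst t j u) (k + j) v = subst (subst t (k + j + 1) v) j (subst u k v) := by
  induction t generalizing j with
  | var n =>
    rcases lt_trichotomy n j with h | rfl | h
    · simp only [subst, if_pos h, if_pos (show n < k + j by omega),
        if_pos (show n < k + j + 1 by omega)]
    · simp only [subst, lt_irrefl, if_true, if_false, if_pos (show n < k + n + 1 by omega),
        subst_liftN]
    · rcases eq_or_ne n (k + j + 1) with rfl | hn
      · simp only [subst, lt_irrefl, if_true, if_false, if_neg (show ¬ k + j + 1 < j by omega),
          if_neg (show k + j + 1 ≠ j by omega), Nat.add_sub_cancel]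
        rw [← lift_liftN_of_le (Nat.le_add_left j k), subst_lift]
      · simp only [subst, if_neg (show ¬ n < j by omega), if_neg (show n ≠ j by omega), if_neg hn]
        split_ifs <;> simp only [subst] <;> split_ifs <;> grind
  | app a b iha ihb => simp only [subst, iha, ihb]
  | lam a ih => simp only [subst]; rw [Nat.add_assoc k j 1, ih]
  | bang a ih => simp only [subst, ih]
  | der a ih => simp only [subst, ih]
  | sub a b iha ihb => simp only [subst, ihb]; rw [Nat.add_assoc k j 1, iha]

end T

open T

/-! ### Redexes at a distance -/

/-- The number of distinguished bound variables of the second component of a redex. -/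
def Rule.depth : Rule → ℕ
  | dB => 0
  | sBang => 1
  | dBang => 0

/-- `Fire R w a r`: the term `a` is a list context around an abstraction or a `!`, and `r` is
the contractum of the `R`-redex formed by `a` and `w`. For `dB`, `w` is the argument; for `s!`,
`w` is the body of the explicit substitution; for `d!`, `w` is irrelevant. -/
inductive Fire : Rule → T → T → T → Prop
  | dB (w t : T) : Fire Rule.dB w (lam t) (sub t w)
  | sBang (w u : T) : Fire Rule.sBang w (bang u) (subst w 0 u)
  | dBang (w t : T) : Fire Rule.dBang w (bang t) t
  | sub {R : Rule} {w s r : T} (a : T) :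
      Fire R (lift R.depth w) s r → Fire R w (sub s a) (sub r a)

namespace Fire

variable {R : Rule} {w a r r' s c : T}

theorem unique (h : Fire R w a r) (h' : Fire R w a r') : r = r' := by
  induction h generalizing r' with
  | dB | sBang | dBang => cases h'; rfl
  | sub a _ ih => cases h' with | sub _ h' => rw [ih h']

theorem dBang_irrel (h : Fire Rule.dBang w a r) (w' : T) : Fire Rule.dBang w' a r := by
  generalize hR : Rule.dBang = R at h
  induction h generalizing w' with
  | dB | sBang => cases hR
  | dBang => exact .dBang _ _
  | sub a _ ih => subst hR; exact .sub _ (ih _ rfl)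

theorem lift (h : Fire R w a r) (k : ℕ) :
    Fire R (lift (k + R.depth) w) (lift k a) (lift k r) := by
  induction h generalizing k with
  | dB => exact .dB _ _
  | sBang w u => rw [show k = k + 0 from rfl, lift_subst]; exact .sBang _ _
  | dBang => exact .dBang _ _
  | @sub R w s r a _ ih =>
    refine .sub _ ?_
    rw [lift_lift_of_le _ (Nat.le_add_left _ _), Nat.add_right_comm]
    exact ih (k + 1)

theorem subst (h : Fire R w a r) (k : ℕ) (v : T) :
    Fire R (subst w (k + R.depth) v) (subst a k v) (subst r k v) := by
  induction h generalizing k with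
  | dB => exact .dB _ _
  | sBang w u =>
    have := subst_subst w 0 k u v
    rw [Nat.add_zero] at this
    rw [this]; exact .sBang _ _
  | dBang => exact .dBang _ _
  | @sub R w s r a _ ih =>
    refine .sub _ ?_
    rw [lift_subst_of_le _ (Nat.le_add_left _ _), Nat.add_right_comm]
    exact ih (k + 1)

theorem sBang_comm (hc : Fire Rule.sBang s c a) (h : Fire R (T.lift R.depth w) s r) :
    ∃ r', Fire R w a r' ∧ Fire Rule.sBang r c r' := by
  generalize hS : Rule.sBang = S at hc
  induction hc generalizing w r with
  | dB | dBang => cases hS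
  | sBang s u =>
    have := h.subst 0 u
    rw [Nat.zero_add, subst_lift] at this
    exact ⟨_, this, .sBang _ _⟩
  | sub e _ ih =>
    subst hS
    have := h.lift 1
    rw [Nat.add_comm, ← lift_lift_of_le _ le_rfl] at this
    obtain ⟨r', h₁, h₂⟩ := ih this rfl
    exact ⟨_, .sub _ h₁, .sub _ h₂⟩

theorem fillL {L : List T} (h : Fire R ((T.lift R.depth)^[L.length] w) s r) :
    Fire R w (fillL s L) (fillL r L) := by
  induction L generalizing s r with
  | nil => exact h
  | cons a L ih =>
    rw [List.length_cons, Function.iterate_succ_apply'] at h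
    exact ih (.sub a h)

theorem fillL_concat (s a : T) (L : List T) :
    BangPaper.fillL s (L ++ [a]) = .sub (BangPaper.fillL s L) a := by
  induction L generalizing s with
  | nil => rfl
  | cons b L ih => exact ih _

theorem exists_fillL (h : Fire R w a r) :
    ∃ (s q : T) (L : List T), (∀ t b, s ≠ .sub t b) ∧
      Fire R ((T.lift R.depth)^[L.length] w) s q ∧
      a = BangPaper.fillL s L ∧ r = BangPaper.fillL q L := by
  induction h with
  | dB w t => exact ⟨_, _, [], by simp, .dB _ _, rfl, rfl⟩
  | sBang w t => exact ⟨_, _, [], by simp, .sBang _ _, rfl, rfl⟩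
  | dBang w t => exact ⟨_, _, [], by simp, .dBang _ _, rfl, rfl⟩
  | sub e _ ih =>
    obtain ⟨s, q, L, hs, hf, rfl, rfl⟩ := ih
    refine ⟨s, q, L ++ [e], hs, ?_, (fillL_concat _ _ _).symm, (fillL_concat _ _ _).symm⟩
    rw [List.length_append]
    exact hf

theorem root_dB (h : Fire Rule.dB w a r) : Root Rule.dB (app a w) r := by
  obtain ⟨s, q, L, hs, hf, rfl, rfl⟩ := h.exists_fillL
  cases hf with
  | dB => exact .dB _ _ _
  | sub => exact absurd rfl (hs _ _)

theorem root_sBang (h : Fire Rule.sBang w a r) : Root Rule.sBang (.sub w a) r := by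
  obtain ⟨s, q, L, hs, hf, rfl, rfl⟩ := h.exists_fillL
  cases hf with
  | sBang => exact .sBang _ _ _
  | sub => exact absurd rfl (hs _ _)

theorem root_dBang (h : Fire Rule.dBang w a r) : Root Rule.dBang (der a) r := by
  obtain ⟨s, q, L, hs, hf, rfl, rfl⟩ := h.exists_fillL
  cases hf with
  | dBang => exact .dBang _ _
  | sub => exact absurd rfl (hs _ _)

end Fire

/-! ### Surface reduction -/

/-- Surface reduction labelled by its rule, as an inductive predicate. -/
inductive Surf : Rule → T → T → Prop
  | dB {a b r : T} : Fire Rule.dB b a r → Surf Rule.dB (app a b) r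
  | sBang {a b r : T} : Fire Rule.sBang a b r → Surf Rule.sBang (sub a b) r
  | dBang {w a r : T} : Fire Rule.dBang w a r → Surf Rule.dBang (der a) r
  | appL {R : Rule} {a a' : T} (b : T) : Surf R a a' → Surf R (app a b) (app a' b)
  | appR {R : Rule} {b b' : T} (a : T) : Surf R b b' → Surf R (app a b) (app a b')
  | lam {R : Rule} {a a' : T} : Surf R a a' → Surf R (lam a) (lam a')
  | der {R : Rule} {a a' : T} : Surf R a a' → Surf R (der a) (der a')
  | subL {R : Rule} {a a' : T} (b : T) : Surf R a a' → Surf R (sub a b) (sub a' b)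
  | subR {R : Rule} {b b' : T} (a : T) : Surf R b b' → Surf R (sub a b) (sub a b')

theorem Root.surf {R : Rule} {t u : T} (h : Root R t u) : Surf R t u := by
  cases h with
  | dB t u L => exact .dB (Fire.fillL (.dB _ _))
  | sBang t u L => exact .sBang (Fire.fillL (.sBang _ _))
  | dBang t L => exact .dBang (w := t) (Fire.fillL (.dBang _ _))

theorem SStepR.fill {R : Rule} {t u : T} (h : SStepR R t u) {C : Ctx} (hC : C.Surface) :
    SStepR R (C.fill t) (C.fill u) := by
  induction C with
  | hole => exact h
  | bang => exact hC.elim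
  | appL C b ih =>
    obtain ⟨D, hD, x, y, hr, h₁, h₂⟩ := ih hC
    exact ⟨.appL D b, hD, x, y, hr, by rw [Ctx.fill, h₁]; rfl, by rw [Ctx.fill, h₂]; rfl⟩
  | appR b C ih =>
    obtain ⟨D, hD, x, y, hr, h₁, h₂⟩ := ih hC
    exact ⟨.appR b D, hD, x, y, hr, by rw [Ctx.fill, h₁]; rfl, by rw [Ctx.fill, h₂]; rfl⟩
  | lam C ih =>
    obtain ⟨D, hD, x, y, hr, h₁, h₂⟩ := ih hC
    exact ⟨.lam D, hD, x, y, hr, by rw [Ctx.fill, h₁]; rfl, by rw [Ctx.fill, h₂]; rfl⟩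
  | der C ih =>
    obtain ⟨D, hD, x, y, hr, h₁, h₂⟩ := ih hC
    exact ⟨.der D, hD, x, y, hr, by rw [Ctx.fill, h₁]; rfl, by rw [Ctx.fill, h₂]; rfl⟩
  | subL C b ih =>
    obtain ⟨D, hD, x, y, hr, h₁, h₂⟩ := ih hC
    exact ⟨.subL D b, hD, x, y, hr, by rw [Ctx.fill, h₁]; rfl, by rw [Ctx.fill, h₂]; rfl⟩
  | subR b C ih =>
    obtain ⟨D, hD, x, y, hr, h₁, h₂⟩ := ih hC
    exact ⟨.subR b D, hD, x, y, hr, by rw [Ctx.fill, h₁]; rfl, by rw [Ctx.fill, h₂]; rfl⟩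

theorem Root.sStepR {R : Rule} {t u : T} (h : Root R t u) : SStepR R t u :=
  ⟨.hole, trivial, t, u, h, rfl, rfl⟩

theorem sStepR_iff_surf {R : Rule} {t u : T} : SStepR R t u ↔ Surf R t u := by
  constructor
  · rintro ⟨C, hC, a, b, h, rfl, rfl⟩
    induction C with
    | hole => exact h.surf
    | bang => exact hC.elim
    | appL C t ih => exact .appL _ (ih hC)
    | appR t C ih => exact .appR _ (ih hC)
    | lam C ih => exact .lam (ih hC)
    | der C ih => exact .der (ih hC)
    | subL C t ih => exact .subL _ (ih hC)
    | subR t C ih => exact .subR _ (ih hC)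
  · intro h
    induction h with
    | dB h => exact h.root_dB.sStepR
    | sBang h => exact h.root_sBang.sStepR
    | dBang h => exact h.root_dBang.sStepR
    | appL b _ ih => exact ih.fill (C := .appL .hole b) trivial
    | appR a _ ih => exact ih.fill (C := .appR a .hole) trivial
    | lam _ ih => exact ih.fill (C := .lam .hole) trivial
    | der _ ih => exact ih.fill (C := .der .hole) trivial
    | subL b _ ih => exact ih.fill (C := .subL .hole b) trivial
    | subR a _ ih => exact ih.fill (C := .subR a .hole) trivial

namespace Surf

variable {R S : Rule} {t u w w' a a' r : T}

theorem lift (h : Surf R t u) (k : ℕ) : Surf R (lift k t) (lift k u) := by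
  induction h generalizing k with
  | dB h => exact .dB (h.lift k)
  | sBang h => exact .sBang (h.lift k)
  | dBang h => exact .dBang (h.lift k)
  | appL b _ ih => exact .appL _ (ih k)
  | appR a _ ih => exact .appR _ (ih k)
  | lam _ ih => exact .lam (ih _)
  | der _ ih => exact .der (ih k)
  | subL b _ ih => exact .subL _ (ih _)
  | subR a _ ih => exact .subR _ (ih k)

theorem subst (h : Surf R t u) (k : ℕ) (v : T) : Surf R (subst t k v) (subst u k v) := by
  induction h generalizing k with
  | dB h => exact .dB (h.subst k v)
  | sBang h => exact .sBang (h.subst k v)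
  | dBang h => exact .dBang (h.subst k v)
  | appL b _ ih => exact .appL _ (ih k)
  | appR a _ ih => exact .appR _ (ih k)
  | lam _ ih => exact .lam (ih _)
  | der _ ih => exact .der (ih k)
  | subL b _ ih => exact .subL _ (ih _)
  | subR a _ ih => exact .subR _ (ih k)

theorem fire_right (h : Surf S a a') (hf : Fire R w a r) :
    ∃ r', Fire R w a' r' ∧ Surf S r r' := by
  induction hf generalizing a' with
  | dB w t => cases h with | lam h => exact ⟨_, .dB _ _, .subL _ h⟩
  | sBang | dBang => cases h
  | sub e hf ih =>
    cases h with
    | sBang h =>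
      obtain ⟨r', h₁, h₂⟩ := h.sBang_comm hf
      exact ⟨r', h₁, .sBang h₂⟩
    | subL _ h =>
      obtain ⟨r', h₁, h₂⟩ := ih h
      exact ⟨_, .sub _ h₁, .subL _ h₂⟩
    | subR _ h => exact ⟨_, .sub _ hf, .subR _ h⟩

theorem fire_left (h : Surf S w w') (hf : Fire R w a r) (hR : R ≠ Rule.dBang) :
    ∃ r', Fire R w' a r' ∧ Surf S r r' := by
  induction hf generalizing w' with
  | dB => exact ⟨_, .dB _ _, .subR _ h⟩
  | sBang => exact ⟨_, .sBang _ _, h.subst _ _⟩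
  | dBang => exact absurd rfl hR
  | sub e _ ih =>
    obtain ⟨r', h₁, h₂⟩ := ih (h.lift _) hR
    exact ⟨_, .sub _ h₁, .subL _ h₂⟩

/-- The labelled diamond property of surface reduction. -/
theorem diamond {u₁ u₂ : T} (h₁ : Surf R t u₁) (h₂ : Surf S t u₂) :
    (R = S ∧ u₁ = u₂) ∨ ∃ s, Surf S u₁ s ∧ Surf R u₂ s := by
  induction h₁ generalizing u₂ with
  | dB hf =>
    cases h₂ with
    | dB hf' => exact .inl ⟨rfl, hf.unique hf'⟩
    | appL _ h => obtain ⟨s, h₁, h₂⟩ := h.fire_right hf; exact .inr ⟨s, h₂, .dB h₁⟩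
    | appR _ h => obtain ⟨s, h₁, h₂⟩ := h.fire_left hf (by simp); exact .inr ⟨s, h₂, .dB h₁⟩
  | sBang hf =>
    cases h₂ with
    | sBang hf' => exact .inl ⟨rfl, hf.unique hf'⟩
    | subR _ h => obtain ⟨s, h₁, h₂⟩ := h.fire_right hf; exact .inr ⟨s, h₂, .sBang h₁⟩
    | subL _ h => obtain ⟨s, h₁, h₂⟩ := h.fire_left hf (by simp); exact .inr ⟨s, h₂, .sBang h₁⟩
  | dBang hf =>
    cases h₂ with
    | dBang hf' => exact .inl ⟨rfl, hf.unique (hf'.dBang_irrel _)⟩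
    | der h => obtain ⟨s, h₁, h₂⟩ := h.fire_right hf; exact .inr ⟨s, h₂, .dBang h₁⟩
  | appL b h ih =>
    cases h₂ with
    | dB hf => obtain ⟨s, h₁, h₂⟩ := h.fire_right hf; exact .inr ⟨s, .dB h₁, h₂⟩
    | appL _ h' =>
      obtain ⟨rfl, rfl⟩ | ⟨s, h₁, h₂⟩ := ih h'
      · exact .inl ⟨rfl, rfl⟩
      · exact .inr ⟨_, .appL _ h₁, .appL _ h₂⟩
    | appR _ h' => exact .inr ⟨_, .appR _ h', .appL _ h⟩
  | appR a h ih =>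
    cases h₂ with
    | dB hf => obtain ⟨s, h₁, h₂⟩ := h.fire_left hf (by simp); exact .inr ⟨s, .dB h₁, h₂⟩
    | appR _ h' =>
      obtain ⟨rfl, rfl⟩ | ⟨s, h₁, h₂⟩ := ih h'
      · exact .inl ⟨rfl, rfl⟩
      · exact .inr ⟨_, .appR _ h₁, .appR _ h₂⟩
    | appL _ h' => exact .inr ⟨_, .appL _ h', .appR _ h⟩
  | lam h ih =>
    cases h₂ with
    | lam h' =>
      obtain ⟨rfl, rfl⟩ | ⟨s, h₁, h₂⟩ := ih h'
      · exact .inl ⟨rfl, rfl⟩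
      · exact .inr ⟨_, .lam h₁, .lam h₂⟩
  | der h ih =>
    cases h₂ with
    | dBang hf => obtain ⟨s, h₁, h₂⟩ := h.fire_right hf; exact .inr ⟨s, .dBang h₁, h₂⟩
    | der h' =>
      obtain ⟨rfl, rfl⟩ | ⟨s, h₁, h₂⟩ := ih h'
      · exact .inl ⟨rfl, rfl⟩
      · exact .inr ⟨_, .der h₁, .der h₂⟩
  | subL b h ih =>
    cases h₂ with
    | sBang hf => obtain ⟨s, h₁, h₂⟩ := h.fire_left hf (by simp); exact .inr ⟨s, .sBang h₁, h₂⟩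
    | subL _ h' =>
      obtain ⟨rfl, rfl⟩ | ⟨s, h₁, h₂⟩ := ih h'
      · exact .inl ⟨rfl, rfl⟩
      · exact .inr ⟨_, .subL _ h₁, .subL _ h₂⟩
    | subR _ h' => exact .inr ⟨_, .subR _ h', .subL _ h⟩
  | subR a h ih =>
    cases h₂ with
    | sBang hf => obtain ⟨s, h₁, h₂⟩ := h.fire_right hf; exact .inr ⟨s, .sBang h₁, h₂⟩
    | subR _ h' =>
      obtain ⟨rfl, rfl⟩ | ⟨s, h₁, h₂⟩ := ih h'
      · exact .inl ⟨rfl, rfl⟩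
      · exact .inr ⟨_, .subR _ h₁, .subR _ h₂⟩
    | subL _ h' => exact .inr ⟨_, .subL _ h', .subR _ h⟩

end Surf

/-- The labelled diamond property of `→S`. -/
theorem SStepR.diamond {R S : Rule} {t u₁ u₂ : T} (h₁ : SStepR R t u₁) (h₂ : SStepR S t u₂) :
    (R = S ∧ u₁ = u₂) ∨ ∃ s, SStepR S u₁ s ∧ SStepR R u₂ s := by
  simp only [sStepR_iff_surf] at *
  exact h₁.diamond h₂

/-- `SSteps c t u`: a surface reduction sequence from `t` to `u` with `c R` steps of each
rule `R`. -/
inductive SSteps : (Rule → ℕ) → T → T → Prop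
  | refl (t : T) : SSteps 0 t t
  | head {R : Rule} {c : Rule → ℕ} {t u v : T} :
      SStepR R t u → SSteps c u v → SSteps (c + Set.indicator {R} 1) t v

theorem Counted3.sSteps {m n k : ℕ} {t u : T}
    (h : Counted3 (SStepR Rule.dB) (SStepR Rule.sBang) (SStepR Rule.dBang) m n k t u) :
    SSteps (fun R => Rule.casesOn R m n k) t u := by
  induction h with
  | refl t => convert SSteps.refl t using 1; funext R; cases R <;> rfl
  | step₁ h _ ih | step₂ h _ ih | step₃ h _ ih =>
    convert SSteps.head h ih using 1; funext R; cases R <;> simp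

/-- A surface step can be postponed to a normalizing sequence, which it shortens by one step of
the same rule. -/
theorem SSteps.exists_of_sStepR {c : Rule → ℕ} {R : Rule} {t u v : T} (h : SSteps c t v)
    (hv : IsNF SStep v) (hu : SStepR R t u) :
    ∃ d, c = d + Set.indicator {R} 1 ∧ SSteps d u v := by
  induction h generalizing R u with
  | refl => exact absurd ⟨R, hu⟩ (hv u)
  | @head S c t t' v h h' ih =>
    obtain ⟨rfl, rfl⟩ | ⟨s, h₁, h₂⟩ := hu.diamond h
    · exact ⟨c, rfl, h'⟩
    · obtain ⟨d, rfl, hd⟩ := ih hv h₂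
      exact ⟨_, add_right_comm _ _ _, .head h₁ hd⟩

theorem SSteps.unique {c d : Rule → ℕ} {t u v : T} (h : SSteps c t u) (hu : IsNF SStep u)
    (h' : SSteps d t v) (hv : IsNF SStep v) : c = d := by
  induction h generalizing d with
  | refl =>
    cases h' with
    | refl => rfl
    | head h _ => exact absurd ⟨_, h⟩ (hu _)
  | head h _ ih =>
    obtain ⟨d, rfl, hd⟩ := h'.exists_of_sStepR hv h
    rw [ih hu hd]

/-! ### Parallel reduction -/

/-- Parallel reduction: redexes created along a parallel step from subterms may be fired too. -/
inductive Par : T → T → Prop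
  | var (n : ℕ) : Par (var n) (var n)
  | app {a a' b b' : T} : Par a a' → Par b b' → Par (app a b) (app a' b')
  | lam {a a' : T} : Par a a' → Par (lam a) (lam a')
  | bang {a a' : T} : Par a a' → Par (bang a) (bang a')
  | der {a a' : T} : Par a a' → Par (der a) (der a')
  | sub {a a' b b' : T} : Par a a' → Par b b' → Par (sub a b) (sub a' b')
  | dB {a a' b b' r : T} : Par a a' → Par b b' → Fire Rule.dB b' a' r → Par (app a b) r
  | sBang {a a' b b' r : T} : Par a a' → Par b b' → Fire Rule.sBang a' b' r → Par (sub a b) r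
  | dBang {w a a' r : T} : Par a a' → Fire Rule.dBang w a' r → Par (der a) r

namespace Par

variable {R : Rule} {t t' u u' w w' a a' r : T}

theorem refl (t : T) : Par t t := by
  induction t with
  | var n => exact .var n
  | app _ _ ha hb => exact .app ha hb
  | lam _ h => exact .lam h
  | bang _ h => exact .bang h
  | der _ h => exact .der h
  | sub _ _ ha hb => exact .sub ha hb

theorem lift (h : Par t t') (k : ℕ) : Par (lift k t) (lift k t') := by
  induction h generalizing k with
  | var n => exact refl _
  | app _ _ ha hb => exact .app (ha k) (hb k)
  | lam _ h => exact .lam (h _)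
  | bang _ h => exact .bang (h k)
  | der _ h => exact .der (h k)
  | sub _ _ ha hb => exact .sub (ha _) (hb k)
  | dB _ _ hf ha hb => exact .dB (ha k) (hb k) (hf.lift k)
  | sBang _ _ hf ha hb => exact .sBang (ha _) (hb k) (hf.lift k)
  | dBang _ hf h => exact .dBang (h k) (hf.lift k)

theorem liftN (h : Par t t') (k : ℕ) : Par (liftN k t) (liftN k t') := by
  induction k with
  | zero => exact h
  | succ k ih => rw [liftN_succ, liftN_succ]; exact ih.lift 0

theorem subst (h : Par t t') (hu : Par u u') (k : ℕ) : Par (subst t k u) (subst t' k u') := by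
  induction h generalizing k with
  | var n => simp only [T.subst]; split_ifs; exacts [refl _, hu.liftN k, refl _]
  | app _ _ ha hb => exact .app (ha k) (hb k)
  | lam _ h => exact .lam (h _)
  | bang _ h => exact .bang (h k)
  | der _ h => exact .der (h k)
  | sub _ _ ha hb => exact .sub (ha _) (hb k)
  | dB _ _ hf ha hb => exact .dB (ha k) (hb k) (hf.subst k _)
  | sBang _ _ hf ha hb => exact .sBang (ha _) (hb k) (hf.subst k _)
  | dBang _ hf h => exact .dBang (h k) (hf.subst k _)

theorem fire (hf : Fire R w a r) (hw : Par w w') (ha : Par a a') :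
    ∃ r', Fire R w' a' r' ∧ Par r r' := by
  induction hf generalizing w' a' with
  | dB => cases ha with | lam h => exact ⟨_, .dB _ _, .sub h hw⟩
  | sBang => cases ha with | bang h => exact ⟨_, .sBang _ _, hw.subst h 0⟩
  | dBang => cases ha with | bang h => exact ⟨_, .dBang _ _, h⟩
  | sub e _ ih =>
    cases ha with
    | sub hs he =>
      obtain ⟨r', h₁, h₂⟩ := ih (hw.lift _) hs
      exact ⟨_, .sub _ h₁, .sub h₂ he⟩
    | sBang hs he hf =>
      obtain ⟨r', h₁, h₂⟩ := ih (hw.lift _) hs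
      obtain ⟨r'', h₃, h₄⟩ := hf.sBang_comm h₁
      exact ⟨r'', h₃, .sBang h₂ he h₄⟩

theorem diamond {u₁ u₂ : T} (h₁ : Par t u₁) (h₂ : Par t u₂) : ∃ s, Par u₁ s ∧ Par u₂ s := by
  induction h₁ generalizing u₂ with
  | var n => exact ⟨_, h₂, refl _⟩
  | app _ _ iha ihb =>
    cases h₂ with
    | app ha hb =>
      obtain ⟨_, ha₁, ha₂⟩ := iha ha
      obtain ⟨_, hb₁, hb₂⟩ := ihb hb
      exact ⟨_, .app ha₁ hb₁, .app ha₂ hb₂⟩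
    | dB ha hb hf =>
      obtain ⟨_, ha₁, ha₂⟩ := iha ha
      obtain ⟨_, hb₁, hb₂⟩ := ihb hb
      obtain ⟨s, hs, hp⟩ := fire hf hb₂ ha₂
      exact ⟨s, .dB ha₁ hb₁ hs, hp⟩
  | lam _ ih =>
    cases h₂ with
    | lam h => obtain ⟨_, h₁, h₂⟩ := ih h; exact ⟨_, .lam h₁, .lam h₂⟩
  | bang _ ih =>
    cases h₂ with
    | bang h => obtain ⟨_, h₁, h₂⟩ := ih h; exact ⟨_, .bang h₁, .bang h₂⟩
  | der _ ih =>
    cases h₂ with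
    | der h => obtain ⟨_, h₁, h₂⟩ := ih h; exact ⟨_, .der h₁, .der h₂⟩
    | dBang h hf =>
      obtain ⟨_, h₁, h₂⟩ := ih h
      obtain ⟨s, hs, hp⟩ := fire hf (refl _) h₂
      exact ⟨s, .dBang h₁ hs, hp⟩
  | sub _ _ iha ihb =>
    cases h₂ with
    | sub ha hb =>
      obtain ⟨_, ha₁, ha₂⟩ := iha ha
      obtain ⟨_, hb₁, hb₂⟩ := ihb hb
      exact ⟨_, .sub ha₁ hb₁, .sub ha₂ hb₂⟩
    | sBang ha hb hf =>
      obtain ⟨_, ha₁, ha₂⟩ := iha ha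
      obtain ⟨_, hb₁, hb₂⟩ := ihb hb
      obtain ⟨s, hs, hp⟩ := fire hf ha₂ hb₂
      exact ⟨s, .sBang ha₁ hb₁ hs, hp⟩
  | dB _ _ hf iha ihb =>
    cases h₂ with
    | app ha hb =>
      obtain ⟨_, ha₁, ha₂⟩ := iha ha
      obtain ⟨_, hb₁, hb₂⟩ := ihb hb
      obtain ⟨s, hs, hp⟩ := fire hf hb₁ ha₁
      exact ⟨s, hp, .dB ha₂ hb₂ hs⟩
    | dB ha hb hf' =>
      obtain ⟨_, ha₁, ha₂⟩ := iha ha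
      obtain ⟨_, hb₁, hb₂⟩ := ihb hb
      obtain ⟨s, hs, hp⟩ := fire hf hb₁ ha₁
      obtain ⟨s', hs', hp'⟩ := fire hf' hb₂ ha₂
      exact ⟨s, hp, hs.unique hs' ▸ hp'⟩
  | sBang _ _ hf iha ihb =>
    cases h₂ with
    | sub ha hb =>
      obtain ⟨_, ha₁, ha₂⟩ := iha ha
      obtain ⟨_, hb₁, hb₂⟩ := ihb hb
      obtain ⟨s, hs, hp⟩ := fire hf ha₁ hb₁
      exact ⟨s, hp, .sBang ha₂ hb₂ hs⟩
    | sBang ha hb hf' =>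
      obtain ⟨_, ha₁, ha₂⟩ := iha ha
      obtain ⟨_, hb₁, hb₂⟩ := ihb hb
      obtain ⟨s, hs, hp⟩ := fire hf ha₁ hb₁
      obtain ⟨s', hs', hp'⟩ := fire hf' ha₂ hb₂
      exact ⟨s, hp, hs.unique hs' ▸ hp'⟩
  | dBang _ hf ih =>
    cases h₂ with
    | der h =>
      obtain ⟨_, h₁, h₂⟩ := ih h
      obtain ⟨s, hs, hp⟩ := fire hf (refl _) h₁
      exact ⟨s, hp, .dBang h₂ hs⟩
    | dBang h hf' =>
      obtain ⟨_, h₁, h₂⟩ := ih h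
      obtain ⟨s, hs, hp⟩ := fire hf (refl _) h₁
      obtain ⟨s', hs', hp'⟩ := fire (hf'.dBang_irrel _) (refl _) h₂
      exact ⟨s, hp, hs.unique hs' ▸ hp'⟩

end Par

theorem Root.par {R : Rule} {t u : T} (h : Root R t u) : Par t u := by
  cases h with
  | dB t u L => exact .dB (Par.refl _) (Par.refl _) (Fire.fillL (.dB _ _))
  | sBang t u L => exact .sBang (Par.refl _) (Par.refl _) (Fire.fillL (.sBang _ _))
  | dBang t L => exact .dBang (w := t) (Par.refl _) (Fire.fillL (.dBang _ _))

theorem FStep.par {t u : T} (h : FStep t u) : Par t u := by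
  obtain ⟨R, C, a, b, h, rfl, rfl⟩ := h
  induction C with
  | hole => exact h.par
  | appL C t ih => exact .app ih (Par.refl _)
  | appR t C ih => exact .app (Par.refl _) ih
  | lam C ih => exact .lam ih
  | bang C ih => exact .bang ih
  | der C ih => exact .der ih
  | subL C t ih => exact .sub ih (Par.refl _)
  | subR t C ih => exact .sub (Par.refl _) ih

/-- Composition of contexts. -/
def Ctx.comp : Ctx → Ctx → Ctx
  | hole, D => D
  | appL C t, D => appL (comp C D) t
  | appR t C, D => appR t (comp C D)
  | lam C, D => lam (comp C D)
  | bang C, D => bang (comp C D)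
  | der C, D => der (comp C D)
  | subL C t, D => subL (comp C D) t
  | subR t C, D => subR t (comp C D)

theorem Ctx.fill_comp (C D : Ctx) (s : T) : (C.comp D).fill s = C.fill (D.fill s) := by
  induction C <;> simp_all [Ctx.comp, Ctx.fill]

theorem FStep.fill {t u : T} (h : FStep t u) (C : Ctx) : FStep (C.fill t) (C.fill u) := by
  obtain ⟨R, D, a, b, h, rfl, rfl⟩ := h
  exact ⟨R, C.comp D, a, b, h, (C.fill_comp D a).symm, (C.fill_comp D b).symm⟩

theorem Root.fStep {R : Rule} {t u : T} (h : Root R t u) : FStep t u :=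
  ⟨R, .hole, t, u, h, rfl, rfl⟩

open Relation in
theorem Par.fSteps {t u : T} (h : Par t u) : ReflTransGen FStep t u := by
  have fill {t u : T} (C : Ctx) (h : ReflTransGen FStep t u) :
      ReflTransGen FStep (C.fill t) (C.fill u) := h.lift _ fun _ _ h => h.fill C
  have app {a a' b b' : T} (ha : ReflTransGen FStep a a') (hb : ReflTransGen FStep b b') :
      ReflTransGen FStep (T.app a b) (T.app a' b') :=
    (fill (.appL .hole b) ha).trans (fill (.appR a' .hole) hb)
  have sub {a a' b b' : T} (ha : ReflTransGen FStep a a') (hb : ReflTransGen FStep b b') :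
      ReflTransGen FStep (T.sub a b) (T.sub a' b') :=
    (fill (.subL .hole b) ha).trans (fill (.subR a' .hole) hb)
  induction h with
  | var => exact .refl
  | app _ _ ha hb => exact app ha hb
  | lam _ h => exact fill (.lam .hole) h
  | bang _ h => exact fill (.bang .hole) h
  | der _ h => exact fill (.der .hole) h
  | sub _ _ ha hb => exact sub ha hb
  | dB _ _ hf ha hb => exact (app ha hb).tail hf.root_dB.fStep
  | sBang _ _ hf ha hb => exact (sub ha hb).tail hf.root_sBang.fStep
  | dBang _ hf h => exact (fill (.der .hole) h).tail hf.root_dBang.fStep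

open Relation in
theorem reflTransGen_fStep_eq : ReflTransGen FStep = ReflTransGen Par := by
  ext t u
  constructor <;> intro h
  · exact h.lift id fun _ _ h => h.par
  · exact h.trans_induction_on (fun _ => .refl) (fun h => h.fSteps) fun _ _ => .trans

/-- **Confluence of the distant Bang calculus λ!.**
(Surface) `→S` is confluent; moreover any two surface reduction sequences from a common
term to `→S`-normal forms have the same length and the same number of `dB`-, `s!`- and
`d!`-steps.  (Full) `→F` is confluent. -/
theorem bang_confluence :
    ((∀ t u₁ u₂ : T, Relation.ReflTransGen SStep t u₁ →
        Relation.ReflTransGen SStep t u₂ →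
        ∃ s, Relation.ReflTransGen SStep u₁ s ∧ Relation.ReflTransGen SStep u₂ s) ∧
      (∀ (t u₁ u₂ : T) (m₁ n₁ k₁ m₂ n₂ k₂ : ℕ),
        Counted3 (SStepR Rule.dB) (SStepR Rule.sBang) (SStepR Rule.dBang)
          m₁ n₁ k₁ t u₁ → IsNF SStep u₁ →
        Counted3 (SStepR Rule.dB) (SStepR Rule.sBang) (SStepR Rule.dBang)
          m₂ n₂ k₂ t u₂ → IsNF SStep u₂ →
        m₁ + n₁ + k₁ = m₂ + n₂ + k₂ ∧ m₁ = m₂ ∧ n₁ = n₂ ∧ k₁ = k₂)) ∧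
    (∀ t u₁ u₂ : T, Relation.ReflTransGen FStep t u₁ →
      Relation.ReflTransGen FStep t u₂ →
      ∃ s, Relation.ReflTransGen FStep u₁ s ∧ Relation.ReflTransGen FStep u₂ s) := by
  refine ⟨⟨fun t u₁ u₂ h₁ h₂ => ?_, fun t u₁ u₂ m₁ n₁ k₁ m₂ n₂ k₂ h₁ hu₁ h₂ hu₂ => ?_⟩,
    fun t u₁ u₂ h₁ h₂ => ?_⟩
  · refine Relation.church_rosser (fun a b c hb hc => ?_) h₁ h₂
    obtain ⟨R, hb⟩ := hb
    obtain ⟨S, hc⟩ := hc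
    obtain ⟨-, rfl⟩ | ⟨s, hs₁, hs₂⟩ := hb.diamond hc
    · exact ⟨b, .refl, .refl⟩
    · exact ⟨s, .single ⟨_, hs₁⟩, .single ⟨_, hs₂⟩⟩
  · have h := h₁.sSteps.unique hu₁ h₂.sSteps hu₂
    have hm : m₁ = m₂ := congrFun h Rule.dB
    have hn : n₁ = n₂ := congrFun h Rule.sBang
    have hk : k₁ = k₂ := congrFun h Rule.dBang
    exact ⟨by rw [hm, hn, hk], hm, hn, hk⟩
  · rw [reflTransGen_fStep_eq] at *
    refine Relation.church_rosser (fun a b c hb hc => ?_) h₁ h₂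
    obtain ⟨s, hs₁, hs₂⟩ := Par.diamond hb hc
    exact ⟨s, .single hs₁, .single hs₂⟩

end BangPaper
end

section
/- (CBN confluence, projected from λ!.) (Surface) The CBN surface reduction →ⁿS is confluent; moreover, any two surface reduction sequences from a common CBN term to a →ⁿS-normal form have the same length and contain the same number of dB-steps and of s-steps. (Full) The CBN full reduction →ⁿF is confluent. -/
namespace BangPaper

namespace LT

/-! ### de Bruijn algebra -/

theorem lift_lift (t : LT) {i j : ℕ} (h : i ≤ j) :
    lift i (lift j t) = lift (j + 1) (lift i t) := by
  induction t generalizing i j with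
  | var n => grind [lift]
  | app a b iha ihb => simp [lift, iha h, ihb h]
  | lam a ih => simp [lift, ih (Nat.succ_le_succ h)]
  | sub a b iha ihb => simp [lift, iha (Nat.succ_le_succ h), ihb h]

@[simp] theorem liftN_zero (t : LT) : liftN 0 t = t := rfl

theorem liftN_succ (m : ℕ) (t : LT) : liftN (m + 1) t = lift 0 (liftN m t) :=
  Function.iterate_succ_apply' _ _ _

theorem lift_liftN_of_le (t : LT) {j m : ℕ} (h : j ≤ m) :
    lift j (liftN m t) = liftN (m + 1) t := by
  induction m generalizing j with
  | zero => rw [Nat.le_zero.mp h, liftN_succ]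
  | succ m ih =>
    cases j with
    | zero => rw [← liftN_succ]
    | succ j =>
      rw [liftN_succ, ← lift_lift _ (Nat.zero_le j), ih (by omega), ← liftN_succ]

theorem lift_add_liftN (t : LT) (j m : ℕ) :
    lift (m + j) (liftN m t) = liftN m (lift j t) := by
  induction m with
  | zero => simp
  | succ m ih =>
    rw [liftN_succ, liftN_succ, show m + 1 + j = (m + j) + 1 by omega,
      ← lift_lift _ (Nat.zero_le _), ih]

theorem lift_subst_of_le (t u : LT) {j k : ℕ} (h : j ≤ k) :
    lift j (subst t k u) = subst (lift j t) (k + 1) u := by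
  induction t generalizing j k with
  | var n => grind [lift, subst, lift_liftN_of_le]
  | app a b iha ihb => simp [lift, subst, iha h, ihb h]
  | lam a ih => simp [lift, subst, ih (Nat.succ_le_succ h)]
  | sub a b iha ihb => simp [lift, subst, iha (Nat.succ_le_succ h), ihb h]

theorem lift_add_subst (t u : LT) (j k : ℕ) :
    lift (k + j) (subst t k u) = subst (lift (k + j + 1) t) k (lift j u) := by
  induction t generalizing k with
  | var n => grind [lift, subst, lift_add_liftN]
  | app a b iha ihb => simp [lift, subst, iha, ihb]
  | lam a ih => simpa [lift, subst, Nat.add_right_comm] using ih (k + 1)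
  | sub a b iha ihb => simpa [lift, subst, Nat.add_right_comm, ihb] using iha (k + 1)

theorem lift_subst_zero (t u : LT) (k : ℕ) :
    lift k (subst t 0 u) = subst (lift (k + 1) t) 0 (lift k u) := by
  simpa using lift_add_subst t u k 0

@[simp] theorem subst_lift_self (t u : LT) (k : ℕ) : subst (lift k t) k u = t := by
  induction t generalizing k with
  | var n => grind [lift, subst]
  | app a b iha ihb => simp [lift, subst, iha, ihb]
  | lam a ih => simp [lift, subst, ih]
  | sub a b iha ihb => simp [lift, subst, iha, ihb]

theorem subst_liftN_add (t u : LT) (k m : ℕ) :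
    subst (liftN m t) (m + k) u = liftN m (subst t k u) := by
  induction m with
  | zero => simp
  | succ m ih =>
    rw [liftN_succ, liftN_succ, ← ih, lift_subst_of_le _ _ (Nat.zero_le _),
      Nat.add_right_comm]

theorem subst_liftN_succ (t u : LT) {i m : ℕ} (h : i ≤ m) :
    subst (liftN (m + 1) t) i u = liftN m t := by
  rw [← lift_liftN_of_le t h, subst_lift_self]

theorem subst_subst (t u v : LT) (i k : ℕ) :
    subst (subst t i u) (i + k) v =
      subst (subst t (i + k + 1) v) i (subst u k v) := by
  induction t generalizing i with
  | var n =>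
    rcases lt_trichotomy n i with h | rfl | h
    · grind [subst]
    · have h' : n < n + k + 1 := by omega
      simp [subst, subst_liftN_add, h']
    · rcases lt_trichotomy n (i + k + 1) with h' | rfl | h'
      · grind [subst]
      · grind [subst, subst_liftN_succ]
      · grind [subst]
  | app a b iha ihb => simp [subst, iha, ihb]
  | lam a ih => simpa [subst, Nat.add_right_comm] using ih (i + 1)
  | sub a b iha ihb => simpa [subst, Nat.add_right_comm, ihb] using iha (i + 1)

theorem subst_zero_subst (t u v : LT) (k : ℕ) :
    subst (subst t 0 u) k v = subst (subst t (k + 1) v) 0 (subst u k v) := by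
  simpa using subst_subst t u v 0 k

end LT

open BangPaper.LT

/-! ### Inductive presentation of the CBN steps -/

/-- `DistBeta t u v`: the application `t u` is a `dB`-redex with contractum `v`. -/
inductive DistBeta : LT → LT → LT → Prop
  | lam (t u : LT) : DistBeta (LT.lam t) u (LT.sub t u)
  | sub {t u v : LT} (a : LT) :
      DistBeta t (LT.lift 0 u) v → DistBeta (LT.sub t a) u (LT.sub v a)

/-- One CBN step, allowed in arguments only when `full` holds. -/
inductive NStep (full : Prop) : NRule → LT → LT → Prop
  | dB {t u v : LT} : DistBeta t u v → NStep full NRule.dB (LT.app t u) v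
  | s (t u : LT) : NStep full NRule.s (LT.sub t u) (LT.subst t 0 u)
  | appL {R : NRule} {t t' : LT} (u : LT) :
      NStep full R t t' → NStep full R (LT.app t u) (LT.app t' u)
  | appR {R : NRule} (t : LT) {u u' : LT} :
      full → NStep full R u u' → NStep full R (LT.app t u) (LT.app t u')
  | lam {R : NRule} {t t' : LT} :
      NStep full R t t' → NStep full R (LT.lam t) (LT.lam t')
  | subL {R : NRule} {t t' : LT} (u : LT) :
      NStep full R t t' → NStep full R (LT.sub t u) (LT.sub t' u)
  | subR {R : NRule} (t : LT) {u u' : LT} :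
      full → NStep full R u u' → NStep full R (LT.sub t u) (LT.sub t u')

theorem fillLN_append_singleton (t a : LT) (L : List LT) :
    fillLN t (L ++ [a]) = LT.sub (fillLN t L) a := by
  induction L generalizing t with
  | nil => rfl
  | cons b L ih => exact ih _

theorem DistBeta.fillLN {t u v : LT} (L : List LT) (h : DistBeta t (liftN L.length u) v) :
    DistBeta (fillLN t L) u (fillLN v L) := by
  induction L generalizing t v with
  | nil => exact h
  | cons a L ih => exact ih (.sub a (by rwa [← liftN_succ]))

theorem DistBeta.exists_fillLN {t u v : LT} (h : DistBeta t u v) :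
    ∃ b L, t = BangPaper.fillLN (LT.lam b) L ∧
      v = BangPaper.fillLN (LT.sub b (liftN L.length u)) L := by
  induction h with
  | lam t u => exact ⟨t, [], rfl, rfl⟩
  | @sub t u v a _ ih =>
    obtain ⟨b, L, rfl, rfl⟩ := ih
    refine ⟨b, L ++ [a], (fillLN_append_singleton _ _ _).symm, ?_⟩
    rw [fillLN_append_singleton, List.length_append, List.length_singleton]
    rfl

theorem DistBeta.nRoot {t u v : LT} (h : DistBeta t u v) : NRoot NRule.dB (LT.app t u) v := by
  obtain ⟨b, L, rfl, rfl⟩ := h.exists_fillLN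
  exact .dB b u L

theorem NRoot.nStep {full : Prop} {R : NRule} {t u : LT} (h : NRoot R t u) :
    NStep full R t u := by
  cases h with
  | dB t u L => exact .dB (DistBeta.fillLN L (.lam _ _))
  | s t u => exact .s t u

theorem NStep.fill {full : Prop} {R : NRule} {t u : LT} (C : LCtx)
    (hC : full ∨ C.NSurface) (h : NStep full R t u) : NStep full R (C.fill t) (C.fill u) := by
  induction C with
  | hole => exact h
  | appL C a ih => exact .appL a (ih hC)
  | appR a C ih =>
    obtain hf := hC.resolve_right id
    exact .appR a hf (ih (.inl hf))
  | lam C ih => exact .lam (ih hC)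
  | subL C a ih => exact .subL a (ih hC)
  | subR a C ih =>
    obtain hf := hC.resolve_right id
    exact .subR a hf (ih (.inl hf))

theorem NStep.exists_nStepAt {full : Prop} {R : NRule} {t u : LT} (h : NStep full R t u) :
    ∃ C : LCtx, (full ∨ C.NSurface) ∧ NStepAt R C t u := by
  induction h with
  | dB h => exact ⟨.hole, .inr trivial, _, _, h.nRoot, rfl, rfl⟩
  | s t u => exact ⟨.hole, .inr trivial, _, _, .s t u, rfl, rfl⟩
  | appL u _ ih =>
    obtain ⟨C, hC, a, b, h, rfl, rfl⟩ := ih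
    exact ⟨.appL C u, hC, a, b, h, rfl, rfl⟩
  | appR t hf _ ih =>
    obtain ⟨C, -, a, b, h, rfl, rfl⟩ := ih
    exact ⟨.appR t C, .inl hf, a, b, h, rfl, rfl⟩
  | lam _ ih =>
    obtain ⟨C, hC, a, b, h, rfl, rfl⟩ := ih
    exact ⟨.lam C, hC, a, b, h, rfl, rfl⟩
  | subL u _ ih =>
    obtain ⟨C, hC, a, b, h, rfl, rfl⟩ := ih
    exact ⟨.subL C u, hC, a, b, h, rfl, rfl⟩
  | subR t hf _ ih =>
    obtain ⟨C, -, a, b, h, rfl, rfl⟩ := ih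
    exact ⟨.subR t C, .inl hf, a, b, h, rfl, rfl⟩

theorem nSStepR_iff {R : NRule} {t u : LT} : NSStepR R t u ↔ NStep False R t u := by
  constructor
  · rintro ⟨C, hC, a, b, h, rfl, rfl⟩
    exact h.nStep.fill C (.inr hC)
  · intro h
    obtain ⟨C, hC, h⟩ := h.exists_nStepAt
    exact ⟨C, hC.resolve_left id, h⟩

theorem nFStepR_iff {R : NRule} {t u : LT} : NFStepR R t u ↔ NStep True R t u := by
  constructor
  · rintro ⟨C, a, b, h, rfl, rfl⟩
    exact h.nStep.fill C (.inl trivial)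
  · intro h
    obtain ⟨C, -, h⟩ := h.exists_nStepAt
    exact ⟨C, h⟩

/-! ### Stability under lifting and substitution -/

theorem DistBeta.lift {t u v : LT} (h : DistBeta t u v) (k : ℕ) :
    DistBeta (LT.lift k t) (LT.lift k u) (LT.lift k v) := by
  induction h generalizing k with
  | lam t u => exact .lam _ _
  | @sub t u v a _ ih =>
    refine .sub _ ?_
    rw [lift_lift _ (Nat.zero_le k)]
    exact ih (k + 1)

theorem DistBeta.subst {t u v : LT} (h : DistBeta t u v) (k : ℕ) (w : LT) :
    DistBeta (LT.subst t k w) (LT.subst u k w) (LT.subst v k w) := by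
  induction h generalizing k with
  | lam t u => exact .lam _ _
  | @sub t u v a _ ih =>
    refine .sub _ ?_
    rw [lift_subst_of_le _ _ (Nat.zero_le k)]
    exact ih (k + 1)

theorem NStep.lift {full : Prop} {R : NRule} {t u : LT} (h : NStep full R t u) (k : ℕ) :
    NStep full R (LT.lift k t) (LT.lift k u) := by
  induction h generalizing k with
  | dB h => exact .dB (h.lift k)
  | s t u => rw [lift_subst_zero]; exact .s _ _
  | appL u _ ih => exact .appL _ (ih k)
  | appR t hf _ ih => exact .appR _ hf (ih k)
  | lam _ ih => exact .lam (ih (k + 1))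
  | subL u _ ih => exact .subL _ (ih (k + 1))
  | subR t hf _ ih => exact .subR _ hf (ih k)

theorem NStep.subst {full : Prop} {R : NRule} {t u : LT} (h : NStep full R t u) (k : ℕ)
    (w : LT) : NStep full R (LT.subst t k w) (LT.subst u k w) := by
  induction h generalizing k with
  | dB h => exact .dB (h.subst k w)
  | s t u => rw [subst_zero_subst]; exact .s _ _
  | appL u _ ih => exact .appL _ (ih k)
  | appR t hf _ ih => exact .appR _ hf (ih k)
  | lam _ ih => exact .lam (ih (k + 1))
  | subL u _ ih => exact .subL _ (ih (k + 1))
  | subR t hf _ ih => exact .subR _ hf (ih k)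

/-! ### The diamond property of surface reduction -/

theorem DistBeta.unique {t u v v' : LT} (h : DistBeta t u v) (h' : DistBeta t u v') :
    v = v' := by
  induction h generalizing v' with
  | lam t u => cases h'; rfl
  | sub a _ ih => cases h' with | sub _ h' => rw [ih h']

theorem DistBeta.of_nStep {R : NRule} {t t' u v : LT} (h : DistBeta t u v)
    (hs : NStep False R t t') : ∃ v', DistBeta t' u v' ∧ NStep False R v v' := by
  induction h generalizing t' with
  | lam t u => cases hs with | lam hs => exact ⟨_, .lam _ _, .subL _ hs⟩
  | @sub t u v a h ih =>
    cases hs with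
    | s => exact ⟨_, by simpa using h.subst 0 a, .s _ _⟩
    | subL _ hs =>
      obtain ⟨v', h', hv⟩ := ih hs
      exact ⟨_, .sub a h', .subL a hv⟩
    | subR _ hf => exact hf.elim

/-- The diamond property of surface reduction, with the rules exchanged along the square. -/
theorem NStep.diamond {R₁ R₂ : NRule} {t u₁ u₂ : LT} (h₁ : NStep False R₁ t u₁)
    (h₂ : NStep False R₂ t u₂) :
    (R₁ = R₂ ∧ u₁ = u₂) ∨ ∃ s, NStep False R₂ u₁ s ∧ NStep False R₁ u₂ s := by
  induction h₁ generalizing u₂ with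
  | dB h =>
    cases h₂ with
    | dB h' => exact .inl ⟨rfl, h.unique h'⟩
    | appL _ h' =>
      obtain ⟨v', hv, hs⟩ := h.of_nStep h'
      exact .inr ⟨v', hs, .dB hv⟩
    | appR _ hf => exact hf.elim
  | s t u =>
    cases h₂ with
    | s => exact .inl ⟨rfl, rfl⟩
    | subL _ h' => exact .inr ⟨_, h'.subst 0 u, .s _ _⟩
    | subR _ hf => exact hf.elim
  | appL u h ih =>
    cases h₂ with
    | dB h' =>
      obtain ⟨v', hv, hs⟩ := h'.of_nStep h
      exact .inr ⟨v', .dB hv, hs⟩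
    | appL _ h' =>
      rcases ih h' with ⟨hR, rfl⟩ | ⟨s, hs₁, hs₂⟩
      · exact .inl ⟨hR, rfl⟩
      · exact .inr ⟨_, .appL u hs₁, .appL u hs₂⟩
    | appR _ hf => exact hf.elim
  | appR _ hf => exact hf.elim
  | lam h ih =>
    cases h₂ with
    | lam h' =>
      rcases ih h' with ⟨hR, rfl⟩ | ⟨s, hs₁, hs₂⟩
      · exact .inl ⟨hR, rfl⟩
      · exact .inr ⟨_, .lam hs₁, .lam hs₂⟩
  | subL u h ih =>
    cases h₂ with
    | s => exact .inr ⟨_, .s _ _, h.subst 0 u⟩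
    | subL _ h' =>
      rcases ih h' with ⟨hR, rfl⟩ | ⟨s, hs₁, hs₂⟩
      · exact .inl ⟨hR, rfl⟩
      · exact .inr ⟨_, .subL u hs₁, .subL u hs₂⟩
    | subR _ hf => exact hf.elim
  | subR _ hf => exact hf.elim

theorem NSStepR.diamond {R₁ R₂ : NRule} {t u₁ u₂ : LT} (h₁ : NSStepR R₁ t u₁)
    (h₂ : NSStepR R₂ t u₂) :
    (R₁ = R₂ ∧ u₁ = u₂) ∨ ∃ s, NSStepR R₂ u₁ s ∧ NSStepR R₁ u₂ s := by
  simp only [nSStepR_iff] at *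
  exact h₁.diamond h₂

theorem nSStep_confluent {t u₁ u₂ : LT} (h₁ : Relation.ReflTransGen NSStep t u₁)
    (h₂ : Relation.ReflTransGen NSStep t u₂) :
    ∃ s, Relation.ReflTransGen NSStep u₁ s ∧ Relation.ReflTransGen NSStep u₂ s := by
  refine Relation.church_rosser ?_ h₁ h₂
  rintro a b c ⟨R₁, hb⟩ ⟨R₂, hc⟩
  rcases hb.diamond hc with ⟨-, rfl⟩ | ⟨s, hs₁, hs₂⟩
  · exact ⟨b, .refl, .refl⟩
  · exact ⟨s, .single ⟨_, hs₁⟩, .single ⟨_, hs₂⟩⟩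

section Counting

variable {α : Type*} {r₁ r₂ : α → α → Prop}

/-- Under the diamond property, a first `r₁`- or `r₂`-step is part of every
counted reduction to a normal form. -/
theorem Counted2.peel
    (h₁₁ : ∀ {a b c}, r₁ a b → r₁ a c → b = c ∨ ∃ d, r₁ b d ∧ r₁ c d)
    (h₁₂ : ∀ {a b c}, r₁ a b → r₂ a c → ∃ d, r₂ b d ∧ r₁ c d)
    (h₂₂ : ∀ {a b c}, r₂ a b → r₂ a c → b = c ∨ ∃ d, r₂ b d ∧ r₂ c d)
    {m n : ℕ} {t u : α} (h : Counted2 r₁ r₂ m n t u)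
    (hu₁ : IsNF r₁ u) (hu₂ : IsNF r₂ u) :
    (∀ t', r₁ t t' → ∃ m', m = m' + 1 ∧ Counted2 r₁ r₂ m' n t' u) ∧
      (∀ t', r₂ t t' → ∃ n', n = n' + 1 ∧ Counted2 r₁ r₂ m n' t' u) := by
  induction h with
  | refl t => exact ⟨fun t' h => (hu₁ t' h).elim, fun t' h => (hu₂ t' h).elim⟩
  | step₁ hs h ih =>
    obtain ⟨ih₁, ih₂⟩ := ih hu₁ hu₂
    constructor
    · intro t' ht'
      rcases h₁₁ hs ht' with rfl | ⟨d, hd, hd'⟩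
      · exact ⟨_, rfl, h⟩
      · obtain ⟨m', rfl, h'⟩ := ih₁ d hd
        exact ⟨_, rfl, .step₁ hd' h'⟩
    · intro t' ht'
      obtain ⟨d, hd, hd'⟩ := h₁₂ hs ht'
      obtain ⟨n', rfl, h'⟩ := ih₂ d hd
      exact ⟨_, rfl, .step₁ hd' h'⟩
  | step₂ hs h ih =>
    obtain ⟨ih₁, ih₂⟩ := ih hu₁ hu₂
    constructor
    · intro t' ht'
      obtain ⟨d, hd, hd'⟩ := h₁₂ ht' hs
      obtain ⟨m', rfl, h'⟩ := ih₁ d hd'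
      exact ⟨_, rfl, .step₂ hd h'⟩
    · intro t' ht'
      rcases h₂₂ hs ht' with rfl | ⟨d, hd, hd'⟩
      · exact ⟨_, rfl, h⟩
      · obtain ⟨n', rfl, h'⟩ := ih₂ d hd
        exact ⟨_, rfl, .step₂ hd' h'⟩

theorem Counted2.unique
    (h₁₁ : ∀ {a b c}, r₁ a b → r₁ a c → b = c ∨ ∃ d, r₁ b d ∧ r₁ c d)
    (h₁₂ : ∀ {a b c}, r₁ a b → r₂ a c → ∃ d, r₂ b d ∧ r₁ c d)
    (h₂₂ : ∀ {a b c}, r₂ a b → r₂ a c → b = c ∨ ∃ d, r₂ b d ∧ r₂ c d)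
    {m n m' n' : ℕ} {t u u' : α} (h : Counted2 r₁ r₂ m n t u)
    (hu₁ : IsNF r₁ u) (hu₂ : IsNF r₂ u) (h' : Counted2 r₁ r₂ m' n' t u')
    (hu₁' : IsNF r₁ u') (hu₂' : IsNF r₂ u') : m = m' ∧ n = n' := by
  induction h generalizing m' n' with
  | refl t =>
    cases h' with
    | refl => exact ⟨rfl, rfl⟩
    | step₁ hs => exact (hu₁ _ hs).elim
    | step₂ hs => exact (hu₂ _ hs).elim
  | step₁ hs _ ih =>
    obtain ⟨k, rfl, hk⟩ := (h'.peel h₁₁ h₁₂ h₂₂ hu₁' hu₂').1 _ hs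
    obtain ⟨rfl, rfl⟩ := ih hu₁ hu₂ hk
    exact ⟨rfl, rfl⟩
  | step₂ hs _ ih =>
    obtain ⟨k, rfl, hk⟩ := (h'.peel h₁₁ h₁₂ h₂₂ hu₁' hu₂').2 _ hs
    obtain ⟨rfl, rfl⟩ := ih hu₁ hu₂ hk
    exact ⟨rfl, rfl⟩

end Counting

theorem nSStep_counts_unique {t u₁ u₂ : LT} {m₁ n₁ m₂ n₂ : ℕ}
    (h₁ : Counted2 (NSStepR NRule.dB) (NSStepR NRule.s) m₁ n₁ t u₁) (hu₁ : IsNF NSStep u₁)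
    (h₂ : Counted2 (NSStepR NRule.dB) (NSStepR NRule.s) m₂ n₂ t u₂) (hu₂ : IsNF NSStep u₂) :
    m₁ = m₂ ∧ n₁ = n₂ :=
  h₁.unique (fun hb hc => (hb.diamond hc).imp_left And.right)
    (fun hb hc => (hb.diamond hc).resolve_left fun h => nomatch h.1)
    (fun hb hc => (hb.diamond hc).imp_left And.right)
    (fun b h => hu₁ b ⟨_, h⟩) (fun b h => hu₁ b ⟨_, h⟩) h₂
    (fun b h => hu₂ b ⟨_, h⟩) (fun b h => hu₂ b ⟨_, h⟩)

/-! ### Confluence from the Z property -/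

/-- A relation with a map satisfying the Z property is confluent. -/
theorem confluent_of_z {α : Type*} {r : α → α → Prop} (f : α → α)
    (hz : ∀ {a b}, r a b → Relation.ReflTransGen r b (f a) ∧ Relation.ReflTransGen r (f a) (f b))
    {a b c : α} (hb : Relation.ReflTransGen r a b) (hc : Relation.ReflTransGen r a c) :
    ∃ d, Relation.ReflTransGen r b d ∧ Relation.ReflTransGen r c d := by
  have hf {a b : α} (h : Relation.ReflTransGen r a b) : Relation.ReflTransGen r (f a) (f b) :=
    Relation.ReflTransGen.lift' f (fun _ _ h => (hz h).2) _ _ h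
  let q (a b : α) : Prop := Relation.ReflTransGen r a b ∧ Relation.ReflTransGen r b (f a)
  have hrq : ∀ a b, r a b → q a b := fun _ _ h => ⟨.single h, (hz h).1⟩
  have hqr {a b : α} (h : Relation.ReflTransGen q a b) : Relation.ReflTransGen r a b :=
    Relation.ReflTransGen.lift' id (fun _ _ h => h.1) _ _ h
  obtain ⟨d, hbd, hcd⟩ := Relation.church_rosser (r := q)
    (fun a b c hb hc => ⟨f a, .single ⟨hb.2, hf hb.1⟩, .single ⟨hc.2, hf hc.1⟩⟩)
    (Relation.ReflTransGen.mono hrq _ _ hb) (Relation.ReflTransGen.mono hrq _ _ hc)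
  exact ⟨d, hqr hbd, hqr hcd⟩

/-! ### Full reduction -/

/-- Many-step CBN full reduction. -/
abbrev NFSteps : LT → LT → Prop := Relation.ReflTransGen NFStep

theorem NStep.nFStep {R : NRule} {t u : LT} (h : NStep True R t u) : NFStep t u :=
  ⟨R, nFStepR_iff.mpr h⟩

theorem NFStep.exists_nStep {t u : LT} (h : NFStep t u) : ∃ R, NStep True R t u :=
  h.imp fun _ => nFStepR_iff.mp

namespace NFSteps

theorem map (f : LT → LT) (hf : ∀ {R t u}, NStep True R t u → NStep True R (f t) (f u))
    {t u : LT} (h : NFSteps t u) : NFSteps (f t) (f u) :=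
  Relation.ReflTransGen.lift f
    (fun _ _ h => let ⟨_, h⟩ := NFStep.exists_nStep h; (hf h).nFStep) _ _ h

theorem app {t t' u u' : LT} (ht : NFSteps t t') (hu : NFSteps u u') :
    NFSteps (LT.app t u) (LT.app t' u') :=
  (map (LT.app · u) (.appL u) ht).trans (map (LT.app t') (.appR t' trivial) hu)

theorem lam {t t' : LT} (ht : NFSteps t t') : NFSteps (LT.lam t) (LT.lam t') :=
  map LT.lam .lam ht

theorem sub {t t' u u' : LT} (ht : NFSteps t t') (hu : NFSteps u u') :
    NFSteps (LT.sub t u) (LT.sub t' u') :=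
  (map (LT.sub · u) (.subL u) ht).trans (map (LT.sub t') (.subR t' trivial) hu)

theorem lift {t t' : LT} (ht : NFSteps t t') (k : ℕ) : NFSteps (LT.lift k t) (LT.lift k t') :=
  map (LT.lift k) (fun h => h.lift k) ht

theorem liftN {t t' : LT} (ht : NFSteps t t') (m : ℕ) :
    NFSteps (LT.liftN m t) (LT.liftN m t') := by
  induction m with
  | zero => exact ht
  | succ m ih => simpa only [liftN_succ] using ih.lift 0

theorem subst_right (t : LT) {u u' : LT} (hu : NFSteps u u') (k : ℕ) :
    NFSteps (LT.subst t k u) (LT.subst t k u') := by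
  induction t generalizing k with
  | var n =>
    simp only [LT.subst]
    split_ifs
    exacts [.refl, hu.liftN k, .refl]
  | app a b iha ihb => exact (iha k).app (ihb k)
  | lam a ih => exact (ih (k + 1)).lam
  | sub a b iha ihb => exact (iha (k + 1)).sub (ihb k)

theorem subst {t t' u u' : LT} (ht : NFSteps t t') (hu : NFSteps u u') (k : ℕ) :
    NFSteps (LT.subst t k u) (LT.subst t' k u') :=
  (map (LT.subst · k u) (fun h => h.subst k u) ht).trans (subst_right t' hu k)

theorem sub_subst (t u : LT) : NFSteps (LT.sub t u) (LT.subst t 0 u) :=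
  .single (NStep.s t u).nFStep

theorem exists_eq_lam {t u : LT} (h : NFSteps (LT.lam t) u) :
    ∃ t', u = LT.lam t' ∧ NFSteps t t' := by
  induction h with
  | refl => exact ⟨t, rfl, .refl⟩
  | tail _ hs ih =>
    obtain ⟨t', rfl, ht⟩ := ih
    obtain ⟨R, hR⟩ := NFStep.exists_nStep hs
    cases hR with
    | lam hb => exact ⟨_, rfl, ht.tail hb.nFStep⟩

end NFSteps

/-- Application of `t` to `u`, contracting the redex if `t` is an abstraction. -/
def applyBeta : LT → LT → LT
  | LT.lam b, u => LT.subst b 0 u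
  | t, u => LT.app t u

theorem applyBeta_cases (t : LT) :
    (∃ b, t = LT.lam b) ∨ ∀ u, applyBeta t u = LT.app t u := by
  cases t with
  | lam b => exact .inl ⟨b, rfl⟩
  | _ => exact .inr fun _ => rfl

theorem app_applyBeta (t u : LT) : NFSteps (LT.app t u) (applyBeta t u) := by
  rcases applyBeta_cases t with ⟨b, rfl⟩ | h
  · exact .head (NStep.dB (.lam b u)).nFStep (NFSteps.sub_subst b u)
  · rw [h]

theorem applyBeta_mono {t t' u u' : LT} (ht : NFSteps t t') (hu : NFSteps u u') :
    NFSteps (applyBeta t u) (applyBeta t' u') := by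
  rcases applyBeta_cases t with ⟨b, rfl⟩ | h
  · obtain ⟨b', rfl, hb⟩ := ht.exists_eq_lam
    exact hb.subst hu 0
  · rw [h]
    exact (ht.app hu).trans (app_applyBeta t' u')

theorem lift_applyBeta (t u : LT) (k : ℕ) :
    LT.lift k (applyBeta t u) = applyBeta (LT.lift k t) (LT.lift k u) := by
  cases t with
  | lam b => exact lift_subst_zero b u k
  | var n => simp only [applyBeta, LT.lift]; split_ifs <;> rfl
  | _ => rfl

theorem applyBeta_subst (t u w : LT) (k : ℕ) :
    NFSteps (LT.subst (applyBeta t u) k w) (applyBeta (LT.subst t k w) (LT.subst u k w)) := by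
  rcases applyBeta_cases t with ⟨b, rfl⟩ | h
  · simp only [applyBeta, LT.subst, subst_zero_subst]
    exact .refl
  · rw [h]
    exact app_applyBeta _ _

/-- The complete superdevelopment of a term. -/
def superdev : LT → LT
  | LT.var n => LT.var n
  | LT.app t u => applyBeta (superdev t) (superdev u)
  | LT.lam t => LT.lam (superdev t)
  | LT.sub t u => LT.subst (superdev t) 0 (superdev u)

theorem nFSteps_superdev (t : LT) : NFSteps t (superdev t) := by
  induction t with
  | var n => exact .refl
  | app a b iha ihb => exact (iha.app ihb).trans (app_applyBeta _ _)
  | lam a ih => exact ih.lam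
  | sub a b iha ihb => exact (iha.sub ihb).trans (NFSteps.sub_subst _ _)

theorem superdev_lift (t : LT) (k : ℕ) : superdev (LT.lift k t) = LT.lift k (superdev t) := by
  induction t generalizing k with
  | var n => simp only [superdev, LT.lift]; split_ifs <;> rfl
  | app a b iha ihb => simp only [superdev, LT.lift, iha, ihb, lift_applyBeta]
  | lam a ih => simp only [superdev, LT.lift, ih]
  | sub a b iha ihb => simp only [superdev, LT.lift, iha, ihb, lift_subst_zero]

theorem superdev_liftN (t : LT) (m : ℕ) : superdev (LT.liftN m t) = LT.liftN m (superdev t) := by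
  induction m with
  | zero => rfl
  | succ m ih => rw [liftN_succ, superdev_lift, ih, liftN_succ]

theorem superdev_subst (t u : LT) (k : ℕ) :
    NFSteps (LT.subst (superdev t) k (superdev u)) (superdev (LT.subst t k u)) := by
  induction t generalizing k with
  | var n =>
    simp only [superdev, LT.subst]
    split_ifs
    · exact .refl
    · rw [superdev_liftN]
    · exact .refl
  | app a b iha ihb => exact (applyBeta_subst _ _ _ k).trans (applyBeta_mono (iha k) (ihb k))
  | lam a ih => exact (ih (k + 1)).lam
  | sub a b iha ihb =>
    simp only [superdev, LT.subst, subst_zero_subst]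
    exact (iha (k + 1)).subst (ihb k) 0

theorem DistBeta.superdev {t u v : LT} (h : DistBeta t u v) :
    ∃ b, superdev t = LT.lam b ∧ superdev v = LT.subst b 0 (superdev u) := by
  induction h with
  | lam t u => exact ⟨_, rfl, rfl⟩
  | @sub t u v a _ ih =>
    obtain ⟨b, hb, hv⟩ := ih
    refine ⟨LT.subst b 1 (BangPaper.superdev a), ?_, ?_⟩
    · simp only [BangPaper.superdev, hb, LT.subst]
    · simp only [BangPaper.superdev, hv, superdev_lift, subst_zero_subst, subst_lift_self]

/-- The Z property of superdevelopments. -/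
theorem NStep.superdev {R : NRule} {t u : LT} (h : NStep True R t u) :
    NFSteps u (superdev t) ∧ NFSteps (superdev t) (superdev u) := by
  induction h with
  | @dB t u v h =>
    obtain ⟨b, hb, hv⟩ := h.superdev
    have heq : BangPaper.superdev (LT.app t u) = BangPaper.superdev v := by
      rw [hv, BangPaper.superdev, hb, applyBeta]
    rw [heq]
    exact ⟨nFSteps_superdev v, .refl⟩
  | s t u =>
    exact ⟨(nFSteps_superdev t).subst (nFSteps_superdev u) 0, superdev_subst t u 0⟩
  | appL u _ ih =>
    exact ⟨(ih.1.app (nFSteps_superdev u)).trans (app_applyBeta _ _),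
      applyBeta_mono ih.2 .refl⟩
  | appR t _ _ ih =>
    exact ⟨((nFSteps_superdev t).app ih.1).trans (app_applyBeta _ _),
      applyBeta_mono .refl ih.2⟩
  | lam _ ih => exact ⟨ih.1.lam, ih.2.lam⟩
  | subL u _ ih =>
    exact ⟨(ih.1.sub (nFSteps_superdev u)).trans (NFSteps.sub_subst _ _), ih.2.subst .refl 0⟩
  | subR t _ _ ih =>
    exact ⟨((nFSteps_superdev t).sub ih.1).trans (NFSteps.sub_subst _ _), .subst .refl ih.2 0⟩

theorem nFStep_confluent {t u₁ u₂ : LT} (h₁ : NFSteps t u₁) (h₂ : NFSteps t u₂) :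
    ∃ s, NFSteps u₁ s ∧ NFSteps u₂ s :=
  confluent_of_z superdev (fun h => let ⟨_, h⟩ := h.exists_nStep; h.superdev) h₁ h₂

/-- **CBN confluence.**  (Surface) `→ⁿS` is confluent; moreover any two surface
reduction sequences from a common CBN term to `→ⁿS`-normal forms have the same length
and the same number of `dB`- and `s`-steps.  (Full) `→ⁿF` is confluent. -/
theorem cbn_confluence :
    ((∀ t u₁ u₂ : LT, Relation.ReflTransGen NSStep t u₁ →
        Relation.ReflTransGen NSStep t u₂ →
        ∃ s, Relation.ReflTransGen NSStep u₁ s ∧ Relation.ReflTransGen NSStep u₂ s) ∧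
      (∀ (t u₁ u₂ : LT) (m₁ n₁ m₂ n₂ : ℕ),
        Counted2 (NSStepR NRule.dB) (NSStepR NRule.s) m₁ n₁ t u₁ → IsNF NSStep u₁ →
        Counted2 (NSStepR NRule.dB) (NSStepR NRule.s) m₂ n₂ t u₂ → IsNF NSStep u₂ →
        m₁ + n₁ = m₂ + n₂ ∧ m₁ = m₂ ∧ n₁ = n₂)) ∧
    (∀ t u₁ u₂ : LT, Relation.ReflTransGen NFStep t u₁ →
      Relation.ReflTransGen NFStep t u₂ →
      ∃ s, Relation.ReflTransGen NFStep u₁ s ∧ Relation.ReflTransGen NFStep u₂ s) := by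
  refine ⟨⟨fun _ _ _ => nSStep_confluent, fun _ _ _ _ _ _ _ h₁ hu₁ h₂ hu₂ => ?_⟩,
    fun _ _ _ => nFStep_confluent⟩
  obtain ⟨rfl, rfl⟩ := nSStep_counts_unique h₁ hu₁ h₂ hu₂
  exact ⟨rfl, rfl, rfl⟩

end BangPaper
end
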